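/- Let Φ ∈ ℝ^{m×N} satisfy the RIP of order t with constant δ ∈ [0,1], and let μ ≥ 0 be a real number. Then for any vector w ∈ ℝ^N and any two distinct indices i, j ∈ {1,…,N} with |supp(w) ∪ {i, j}| ≤ t, one has |((μΦ*Φ − I)w)_i| + |((μΦ*Φ − I)w)_j| ≤ √2·(|μ−1| + μδ)·‖w‖₂, where I is the N×N identity matrix and v_i denotes the i-th entry of a vector v. -/

import Mathlib

open Matrix Finset

/-- The Euclidean norm of a vector in `ℝⁿ`. -/
noncomputable def norm2 {n : ℕ} (v : Fin n → ℝ) : ℝ := Real.sqrt (∑ i, (v i) ^ 2)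

/-- The support of a vector: the set of indices of its nonzero entries. -/
noncomputable def supp {n : ℕ} (v : Fin n → ℝ) : Finset (Fin n) :=
  Finset.univ.filter (fun i => v i ≠ 0)

/-- `restrict v T` keeps the entries of `v` with indices in `T` and sets all others to zero. -/
def restrict {n : ℕ} (v : Fin n → ℝ) (T : Finset (Fin n)) : Fin n → ℝ :=
  fun i => if i ∈ T then v i else 0

/-- `Φ` satisfies the restricted isometry property of order `t` with constant `δ`. -/
def RIP (m N : ℕ) (Φ : Matrix (Fin m) (Fin N) ℝ) (t : ℕ) (δ : ℝ) : Prop :=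
  ∀ v : Fin N → ℝ, (supp v).card ≤ t →
    (1 - δ) * (norm2 v) ^ 2 ≤ (norm2 (Φ.mulVec v)) ^ 2 ∧
    (norm2 (Φ.mulVec v)) ^ 2 ≤ (1 + δ) * (norm2 v) ^ 2

/-- `z` is a least-squares solution over support `T` for data `y`. -/
def IsLeastSquares {m N : ℕ} (Φ : Matrix (Fin m) (Fin N) ℝ) (y : Fin m → ℝ)
    (T : Finset (Fin N)) (z : Fin N → ℝ) : Prop :=
  supp z ⊆ T ∧ ∀ w : Fin N → ℝ, supp w ⊆ T →
    norm2 (y - Φ.mulVec z) ≤ norm2 (y - Φ.mulVec w)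

/-- `U` is a set of indices of the `k` largest magnitude entries of `v`. -/
def IsLargest {n : ℕ} (v : Fin n → ℝ) (k : ℕ) (U : Finset (Fin n)) : Prop :=
  U.card = k ∧ ∀ i ∈ U, ∀ j ∉ U, |v j| ≤ |v i|

theorem norm2_sq {n : ℕ} (v : Fin n → ℝ) : norm2 v ^ 2 = v ⬝ᵥ v := by
  unfold norm2
  rw [Real.sq_sqrt (Finset.sum_nonneg fun i _ => sq_nonneg _)]
  simp [dotProduct, sq]

theorem quad_bound {m N : ℕ} (Φ : Matrix (Fin m) (Fin N) ℝ) (t : ℕ) (δ μ : ℝ)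
    (hμ : 0 ≤ μ) (hRIP : RIP m N Φ t δ) (x : Fin N → ℝ) (hx : (supp x).card ≤ t) :
    |μ * (Φ.mulVec x ⬝ᵥ Φ.mulVec x) - x ⬝ᵥ x| ≤ (|μ - 1| + μ * δ) * (x ⬝ᵥ x) := by
  obtain ⟨h1, h2⟩ := hRIP x hx
  rw [norm2_sq, norm2_sq] at h1 h2
  have h0 : 0 ≤ x ⬝ᵥ x := by rw [← norm2_sq]; positivity
  have e1 := mul_le_mul_of_nonneg_left h1 hμ
  have e2 := mul_le_mul_of_nonneg_left h2 hμ
  have e3 := mul_le_mul_of_nonneg_right (le_abs_self (μ - 1)) h0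
  have e4 := mul_le_mul_of_nonneg_right (neg_abs_le (μ - 1)) h0
  rw [abs_le]
  constructor <;> nlinarith

theorem opt_bound (B C n : ℝ) (hC : 0 ≤ C) (hn : 0 ≤ n)
    (h : ∀ s : ℝ, 2 * s * B ≤ C * (2 + s ^ 2 * n ^ 2)) : B ≤ Real.sqrt 2 * C * n := by
  rcases hn.eq_or_lt with rfl | hn
  · by_contra hB
    simp only [mul_zero, not_le] at hB
    have := h ((C + 1) / B)
    have e : 2 * ((C + 1) / B) * B = 2 * (C + 1) := by field_simp
    rw [e] at this
    norm_num at this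
    linarith
  · have := h (Real.sqrt 2 / n)
    have h2 : Real.sqrt 2 ^ 2 = 2 := Real.sq_sqrt (by norm_num)
    have hp : 0 < Real.sqrt 2 := by positivity
    have e : (Real.sqrt 2 / n) ^ 2 * n ^ 2 = 2 := by field_simp; exact h2
    rw [e] at this
    have e2 : 2 * (Real.sqrt 2 / n) * B = 2 * (Real.sqrt 2 * B) / n := by ring
    rw [e2, div_le_iff₀ hn] at this
    have h3 : Real.sqrt 2 * B ≤ Real.sqrt 2 * (Real.sqrt 2 * C * n) := by
      have h4 : Real.sqrt 2 * (Real.sqrt 2 * C * n) = Real.sqrt 2 ^ 2 * (C * n) := by ring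
      rw [h4, h2]
      linarith
    exact le_of_mul_le_mul_left h3 hp

theorem sign_bound {m N : ℕ} (Φ : Matrix (Fin m) (Fin N) ℝ) (t : ℕ) (δ μ : ℝ)
    (hδ0 : 0 ≤ δ) (hμ : 0 ≤ μ) (hRIP : RIP m N Φ t δ)
    (w : Fin N → ℝ) (i j : Fin N) (hij : i ≠ j)
    (hcard : (supp w ∪ {i, j}).card ≤ t) (a b : ℝ) (ha : a ^ 2 = 1) (hb : b ^ 2 = 1) :
    a * (μ * (Φᵀ.mulVec (Φ.mulVec w)) i - w i) + b * (μ * (Φᵀ.mulVec (Φ.mulVec w)) j - w j) ≤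
      Real.sqrt 2 * (|μ - 1| + μ * δ) * norm2 w := by
  have hn : 0 ≤ norm2 w := Real.sqrt_nonneg _
  apply opt_bound _ _ _ (by positivity) hn
  intro s
  rw [norm2_sq]
  set u : Fin N → ℝ := Pi.single i a + Pi.single j b with hu
  have hs : ∀ r : ℝ, (supp (u + r • w)).card ≤ t := by
    intro r
    refine le_trans (Finset.card_le_card ?_) hcard
    intro k hk
    simp only [supp, Finset.mem_filter, Finset.mem_univ, true_and, Finset.mem_union,
      Finset.mem_insert, Finset.mem_singleton] at hk ⊢
    by_contra hc
    push Not at hc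
    obtain ⟨h1, h2, h3⟩ := hc
    apply hk
    simp [hu, h1, h2, h3]
  have huv : ∀ v : Fin N → ℝ, u ⬝ᵥ v = a * v i + b * v j := by
    intro v; simp [hu, add_dotProduct]
  have huu : u ⬝ᵥ u = 2 := by
    rw [huv]
    simp [hu, hij, hij.symm]
    nlinarith
  have hM : Φ.mulVec u ⬝ᵥ Φ.mulVec w = u ⬝ᵥ Φᵀ.mulVec (Φ.mulVec w) := by
    rw [Matrix.mulVec_transpose, dotProduct_comm, Matrix.dotProduct_mulVec, dotProduct_comm]
  have q1 : ∀ r : ℝ, (u + r • w) ⬝ᵥ (u + r • w) = 2 + 2 * r * (u ⬝ᵥ w) + r ^ 2 * (w ⬝ᵥ w) := by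
    intro r
    simp only [add_dotProduct, dotProduct_add, smul_dotProduct, dotProduct_smul, smul_eq_mul, huu,
      dotProduct_comm w u]
    ring
  have q2 : ∀ r : ℝ, Φ.mulVec (u + r • w) ⬝ᵥ Φ.mulVec (u + r • w) =
      Φ.mulVec u ⬝ᵥ Φ.mulVec u + 2 * r * (u ⬝ᵥ Φᵀ.mulVec (Φ.mulVec w)) +
        r ^ 2 * (Φ.mulVec w ⬝ᵥ Φ.mulVec w) := by
    intro r
    rw [← hM]
    simp only [Matrix.mulVec_add, Matrix.mulVec_smul, add_dotProduct, dotProduct_add,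
      smul_dotProduct, dotProduct_smul, smul_eq_mul, dotProduct_comm (Φ.mulVec w) (Φ.mulVec u)]
    ring
  have b1 := (abs_le.1 (quad_bound Φ t δ μ hμ hRIP _ (hs s))).2
  have b2 := (abs_le.1 (quad_bound Φ t δ μ hμ hRIP _ (hs (-s)))).1
  rw [q1, q2] at b1 b2
  rw [huv, huv] at b1 b2
  linarith

theorem stmt_17 {m N : ℕ} (Φ : Matrix (Fin m) (Fin N) ℝ) (t : ℕ) (δ μ : ℝ)
    (hδ0 : 0 ≤ δ) (hδ1 : δ ≤ 1) (hμ : 0 ≤ μ) (hRIP : RIP m N Φ t δ)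
    (w : Fin N → ℝ) (i j : Fin N) (hij : i ≠ j)
    (hcard : (supp w ∪ {i, j}).card ≤ t) :
    |μ * (Φᵀ.mulVec (Φ.mulVec w)) i - w i| + |μ * (Φᵀ.mulVec (Φ.mulVec w)) j - w j| ≤
      Real.sqrt 2 * (|μ - 1| + μ * δ) * norm2 w := by
  have key : ∀ x : ℝ, ∃ a : ℝ, a ^ 2 = 1 ∧ |x| = a * x := by
    intro x
    rcases abs_cases x with ⟨h, _⟩ | ⟨h, _⟩
    · exact ⟨1, by norm_num, by rw [h]; ring⟩
    · exact ⟨-1, by norm_num, by rw [h]; ring⟩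
  obtain ⟨a, ha, ea⟩ := key (μ * (Φᵀ.mulVec (Φ.mulVec w)) i - w i)
  obtain ⟨b, hb, eb⟩ := key (μ * (Φᵀ.mulVec (Φ.mulVec w)) j - w j)
  rw [ea, eb]
  exact sign_bound Φ t δ μ hδ0 hμ hRIP w i j hij hcard a b ha hb
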